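/- For all constants C₀ ≥ 1 and C > 0 there exist constants K and C′ (depending only on C₀ and C) such that the following holds for all 0 < δ < 1 and ε > 0. Let 𝒫 ⊂ B(0,1) ⊂ ℝ² be a set of at most δ^{−1} points that are δ^{1/2}-separated, let 𝒞 be a set of at most δ^{−1} algebraic curves in ℝ² each of degree at most C₀, and let A ≥ 1. Suppose that for any two distinct points p, q ∈ 𝒫 there are at most A curves γ ∈ 𝒞 with dist(p, γ) ≤ δ^{1−Cε} and dist(q, γ) ≤ δ^{1−Cε}. Then the number of pairs (p, γ) ∈ 𝒫 × 𝒞 with dist(p, γ) ≤ δ^{1−Cε} is at most K·δ^{−C′ε}·A^{1/2}·δ^{−4/3}. -/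

import Mathlib

open Set Metric

noncomputable section

abbrev R2 : Type := EuclideanSpace ℝ (Fin 2)

/-- `γ` is an algebraic curve in `ℝ²` of degree at most `d`: the zero set of a nonzero
polynomial of degree at most `d`. -/
def IsAlgCurve (d : ℕ) (γ : Set R2) : Prop :=
  ∃ P : MvPolynomial (Fin 2) ℝ, P ≠ 0 ∧ P.totalDegree ≤ d ∧
    γ = {x : R2 | MvPolynomial.eval (fun i => x i) P = 0}

open MvPolynomial in
theorem aux_pderiv_deg (f : MvPolynomial (Fin 2) ℝ) (d : ℕ) (i : Fin 2)
    (h : f.totalDegree ≤ d + 1) : (pderiv i f).totalDegree ≤ d := by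
  rw [totalDegree]
  apply Finset.sup_le
  intro m hm
  rw [mem_support_iff, coeff_pderiv] at hm
  have h1 : m + Finsupp.single i 1 ∈ f.support := by
    rw [mem_support_iff]; intro h0; exact hm (by rw [h0, zero_mul])
  have h2 := (le_totalDegree h1).trans h
  rw [Finsupp.sum_add_index' (by simp) (by simp), Finsupp.sum_single_index rfl] at h2
  omega

open MvPolynomial in
theorem aux_pderiv_ne (f : MvPolynomial (Fin 2) ℝ) (h : ∀ i, pderiv i f = 0) :
    f = C (coeff 0 f) := by
  ext m
  rw [coeff_C]
  split_ifs with hm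
  · rw [hm]
  · have : ∃ i, m i ≠ 0 := by
      by_contra hc
      push Not at hc
      exact hm (by ext i; simp [hc i])
    obtain ⟨i, hi⟩ := this
    have h1 := coeff_pderiv (i := i) f (m - Finsupp.single i 1)
    have h2 : m - Finsupp.single i 1 + Finsupp.single i 1 = m := by
      apply tsub_add_cancel_of_le
      rw [Finsupp.single_le_iff]; omega
    rw [h i, h2] at h1
    simp only [coeff_zero] at h1
    have h3 : (((m - Finsupp.single i 1 : Fin 2 →₀ ℕ) i : ℕ) : ℝ) + 1 ≠ 0 := by positivity
    rcases mul_eq_zero.1 h1.symm with h4 | h4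
    · exact h4
    · exact absurd h4 h3

/-- specialization -/
def spc (k : Fin 2) (a : ℝ) (f : MvPolynomial (Fin 2) ℝ) : Polynomial ℝ :=
  MvPolynomial.aeval (fun i => if i = k then Polynomial.C a else Polynomial.X) f

theorem spc_eval (k : Fin 2) (a t : ℝ) (f : MvPolynomial (Fin 2) ℝ) :
    (spc k a f).eval t = MvPolynomial.eval (fun i => if i = k then a else t) f := by
  unfold spc
  induction f using MvPolynomial.induction_on with
  | C a => simp
  | add p q hp hq => simp [hp, hq]
  | mul_X p n hp =>
    simp only [map_mul, Polynomial.eval_mul, hp, MvPolynomial.aeval_X, MvPolynomial.eval_X]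
    split_ifs <;> simp

theorem spc_deg (k : Fin 2) (a : ℝ) (f : MvPolynomial (Fin 2) ℝ) :
    (spc k a f).natDegree ≤ f.totalDegree := by
  unfold spc
  rw [MvPolynomial.aeval_def, MvPolynomial.eval₂_eq]
  apply Polynomial.natDegree_sum_le_of_forall_le
  intro m hm
  refine le_trans ?_ (MvPolynomial.le_totalDegree hm)
  refine le_trans (Polynomial.natDegree_C_mul_le _ _) ?_
  refine le_trans (Polynomial.natDegree_prod_le _ _) ?_
  rw [Finsupp.sum]
  apply Finset.sum_le_sum
  intro i _
  refine le_trans Polynomial.natDegree_pow_le ?_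
  have : (if i = k then Polynomial.C a else (Polynomial.X : Polynomial ℝ)).natDegree ≤ 1 := by
    split_ifs <;> simp
  nlinarith

theorem deriv_coord (f : MvPolynomial (Fin 2) ℝ) (x : Fin 2 → ℝ) (i : Fin 2) :
    HasDerivAt (fun t => MvPolynomial.eval (Function.update x i t) f)
      (MvPolynomial.eval x (MvPolynomial.pderiv i f)) (x i) := by
  induction f using MvPolynomial.induction_on with
  | C a => simpa using hasDerivAt_const (x i) a
  | add p q hp hq => 
    simp only [map_add]
    exact hp.add hq
  | mul_X p n hp =>
    have hX : HasDerivAt (fun t => Function.update x i t n) (if n = i then 1 else 0) (x i) := by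
      split_ifs with h
      · subst h; simp only [Function.update_self]; exact hasDerivAt_id (x n)
      · simpa [Function.update_of_ne h] using hasDerivAt_const (x i) (x n)
    have := hp.mul hX
    simp only [map_mul, MvPolynomial.eval_X, MvPolynomial.pderiv_mul, map_add]
    refine HasDerivAt.congr_deriv this ?_
    by_cases h : n = i
    · subst h; simp
    · simp [MvPolynomial.pderiv_X_of_ne h, h]

theorem crit (f : MvPolynomial (Fin 2) ℝ) (c : Fin 2 → ℝ) (r : ℝ)
    (x₀ : Fin 2 → ℝ) (hx₀ : x₀ ∈ closedBall c r) (h0 : MvPolynomial.eval x₀ f = 0)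
    (hs : ∀ x ∈ sphere c r, MvPolynomial.eval x f ≠ 0) :
    ∃ x ∈ closedBall c r, ∀ i, MvPolynomial.eval x (MvPolynomial.pderiv i f) = 0 := by
  have hcont : Continuous (fun x : Fin 2 → ℝ => MvPolynomial.eval x f) :=
    MvPolynomial.continuous_eval f
  have key : ∃ x ∈ ball c r, IsLocalExtr (fun x : Fin 2 → ℝ => MvPolynomial.eval x f) x := by
    obtain ⟨u, hu, hu'⟩ := (isCompact_closedBall c r).exists_isMinOn ⟨x₀, hx₀⟩ hcont.continuousOn
    obtain ⟨v, hv, hv'⟩ := (isCompact_closedBall c r).exists_isMaxOn ⟨x₀, hx₀⟩ hcont.continuousOn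
    by_cases hub : u ∈ ball c r
    · exact ⟨u, hub, Or.inl (hu'.isLocalMin (Filter.mem_of_superset (isOpen_ball.mem_nhds hub) ball_subset_closedBall))⟩
    by_cases hvb : v ∈ ball c r
    · exact ⟨v, hvb, Or.inr (hv'.isLocalMax (Filter.mem_of_superset (isOpen_ball.mem_nhds hvb) ball_subset_closedBall))⟩
    exfalso
    have hus : u ∈ sphere c r := by
      simp only [mem_ball, mem_closedBall, mem_sphere] at *; linarith
    have hvs : v ∈ sphere c r := by
      simp only [mem_ball, mem_closedBall, mem_sphere] at *; linarith
    have h1 := hu' hx₀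
    have h2 := hv' hx₀
    simp only [Set.mem_ofPred_eq, h0] at h1 h2
    have hpre : IsPreconnected (sphere c r) := by
      apply isPreconnected_sphere
      rw [rank_fin_fun]; norm_num
    obtain ⟨z, hz, hz'⟩ := hpre.intermediate_value hus hvs hcont.continuousOn ⟨h1, h2⟩
    exact hs z hz hz'
  obtain ⟨x, hx, hex⟩ := key
  refine ⟨x, ball_subset_closedBall hx, fun i => ?_⟩
  have hu : Filter.Tendsto (fun t => Function.update x i t) (nhds (x i)) (nhds x) := by
    have : Continuous (fun t => Function.update x i t) := continuous_const.update i continuous_id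
    simpa using this.tendsto (x i)
  have : IsLocalExtr (fun t => MvPolynomial.eval (Function.update x i t) f) (x i) := by
    rcases hex with h | h
    · left
      have := hu.eventually h
      simpa [IsLocalMin, IsMinFilter] using this
    · right
      have := hu.eventually h
      simpa [IsLocalMax, IsMaxFilter] using this
  exact this.hasDerivAt_eq_zero (deriv_coord f x i)

open Classical in
theorem bad_cols (f : MvPolynomial (Fin 2) ℝ) (hf : f ≠ 0) (d : ℕ) (hd : f.totalDegree ≤ d)
    (k k' : Fin 2) (hk : k ≠ k') (S : Finset ℤ) (h σ : ℝ) (hh : 0 < h) :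
    (S.filter (fun i : ℤ => spc k ((i : ℝ) * h + σ) f = 0)).card ≤ d := by
  have : ∃ z, MvPolynomial.eval z f ≠ 0 := by
    by_contra hc
    push Not at hc
    exact hf (MvPolynomial.funext (fun x => by simp [hc x]))
  obtain ⟨z, hz⟩ := this
  have hsw : ∀ a : ℝ, (fun i => if i = k' then z k' else a) = (fun i => if i = k then a else z k') := by
    intro a
    funext i
    fin_cases i <;> fin_cases k <;> fin_cases k' <;> simp_all
  have hzz : (fun i => if i = k' then z k' else z k) = z := by
    funext i
    fin_cases i <;> fin_cases k <;> fin_cases k' <;> simp_all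
  have hG : spc k' (z k') f ≠ 0 := by
    intro h0
    have := spc_eval k' (z k') (z k) f
    rw [h0, hzz] at this
    simp at this
    exact hz this.symm
  have h1 : (S.filter (fun i : ℤ => spc k ((i : ℝ) * h + σ) f = 0)).card ≤
      (spc k' (z k') f).roots.toFinset.card := by
    apply Finset.card_le_card_of_injOn (fun i : ℤ => (i : ℝ) * h + σ)
    · intro i hi
      have hi' : i ∈ S.filter (fun i : ℤ => spc k ((i : ℝ) * h + σ) f = 0) := hi
      rw [Finset.mem_filter] at hi'
      have hi2 := hi'.2
      show _ ∈ ((spc k' (z k') f).roots.toFinset : Set ℝ)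
      rw [Finset.mem_coe, Multiset.mem_toFinset, Polynomial.mem_roots hG, Polynomial.IsRoot, spc_eval, hsw,
        ← spc_eval, hi2]
      simp
    · intro i _ j _ hij
      have hij' : (i : ℝ) * h + σ = (j : ℝ) * h + σ := hij
      have : (i : ℝ) = j := by
        apply mul_right_cancel₀ hh.ne'; linarith
      exact_mod_cast this
  refine h1.trans ((Multiset.toFinset_card_le _).trans ((Polynomial.card_roots' _).trans
    ((spc_deg _ _ _).trans hd)))

open Classical in
theorem edge_count (f : MvPolynomial (Fin 2) ℝ) (hf : f ≠ 0) (d : ℕ) (hd : f.totalDegree ≤ d)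
    (k k' : Fin 2) (hk : k ≠ k') (S : Finset ℤ) (h σ : ℝ) (hh : 0 < h) :
    ((Fintype.piFinset (fun _ : Fin 2 => S)).filter (fun c =>
      ∃ t : ℝ, MvPolynomial.eval (fun i => if i = k then (c k : ℝ) * h + σ else t) f = 0 ∧
        |t - (c k' : ℝ) * h| ≤ 3 * h)).card ≤ 8 * d * S.card := by
  set F := (Fintype.piFinset (fun _ : Fin 2 => S)).filter (fun c =>
      ∃ t : ℝ, MvPolynomial.eval (fun i => if i = k then (c k : ℝ) * h + σ else t) f = 0 ∧
        |t - (c k' : ℝ) * h| ≤ 3 * h) with hF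
  have hmem : ∀ c ∈ F, ∀ i, c i ∈ S := by
    intro c hc
    rw [hF, Finset.mem_filter, Fintype.mem_piFinset] at hc
    exact hc.1
  have hext : ∀ c c' : Fin 2 → ℤ, c k = c' k → c k' = c' k' → c = c' := by
    intro c c' h1 h2
    funext i
    fin_cases i <;> fin_cases k <;> fin_cases k' <;> simp_all
  have h1 : F.card = ∑ i ∈ S, (F.filter (fun c => c k = i)).card :=
    Finset.card_eq_sum_card_fiberwise (fun c hc => hmem c hc k)
  have h2 : ∀ i ∈ S, (F.filter (fun c => c k = i)).card ≤
      (if spc k ((i : ℝ) * h + σ) f = 0 then S.card else 0) + 7 * d := by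
    intro i hi
    split_ifs with hg
    · refine le_trans ?_ (Nat.le_add_right _ _)
      apply Finset.card_le_card_of_injOn (fun c => c k')
      · intro c hc
        exact hmem c (Finset.mem_filter.1 hc).1 k'
      · intro c hc c' hc' hcc
        exact hext c c' ((Finset.mem_filter.1 hc).2.trans (Finset.mem_filter.1 hc').2.symm) hcc
    · rw [zero_add]
      set g := spc k ((i : ℝ) * h + σ) f with hgdef
      have h3 : (F.filter (fun c => c k = i)).card ≤
          (g.roots.toFinset.biUnion (fun t => Finset.Icc ⌈t / h - 3⌉ ⌊t / h + 3⌋)).card := by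
        apply Finset.card_le_card_of_injOn (fun c => c k')
        · intro c hc
          obtain ⟨hcF, hci⟩ := Finset.mem_filter.1 hc
          obtain ⟨t, ht, ht'⟩ := (Finset.mem_filter.1 hcF).2
          rw [hci, ← spc_eval, ← hgdef] at ht
          rw [Finset.mem_coe, Finset.mem_biUnion]
          refine ⟨t, ?_, ?_⟩
          · rw [Multiset.mem_toFinset, Polynomial.mem_roots hg]; exact ht
          · rw [Finset.mem_Icc, Int.ceil_le, Int.le_floor]
            rw [abs_le] at ht'
            constructor
            · rw [sub_le_iff_le_add, div_le_iff₀ hh]; linarith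
            · rw [← sub_le_iff_le_add, le_div_iff₀ hh]; linarith
        · intro c hc c' hc' hcc
          exact hext c c' ((Finset.mem_filter.1 hc).2.trans (Finset.mem_filter.1 hc').2.symm) hcc
      refine h3.trans ?_
      refine (Finset.card_biUnion_le_card_mul _ _ 7 ?_).trans ?_
      · intro t _
        rw [Int.card_Icc]
        have e1 : (⌊t / h + 3⌋ : ℝ) ≤ t / h + 3 := Int.floor_le _
        have e2 : t / h - 3 ≤ (⌈t / h - 3⌉ : ℝ) := Int.le_ceil _
        have e3 : ((⌊t / h + 3⌋ + 1 - ⌈t / h - 3⌉ : ℤ) : ℝ) ≤ ((7 : ℤ) : ℝ) := by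
          push_cast; linarith
        have e4 : (⌊t / h + 3⌋ + 1 - ⌈t / h - 3⌉ : ℤ) ≤ 7 := by exact_mod_cast e3
        omega
      · have : g.roots.toFinset.card ≤ d := (Multiset.toFinset_card_le _).trans
          ((Polynomial.card_roots' _).trans ((spc_deg _ _ _).trans hd))
        omega
  have h4 := bad_cols f hf d hd k k' hk S h σ hh
  calc F.card ≤ ∑ i ∈ S, ((if spc k ((i : ℝ) * h + σ) f = 0 then S.card else 0) + 7 * d) := by
        rw [h1]; exact Finset.sum_le_sum h2
    _ = (S.filter (fun i : ℤ => spc k ((i : ℝ) * h + σ) f = 0)).card * S.card + S.card * (7 * d) := by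
        rw [Finset.sum_add_distrib, ← Finset.sum_filter]; simp
    _ ≤ d * S.card + S.card * (7 * d) := by gcongr
    _ = 8 * d * S.card := by ring

open Classical in
theorem cell_count (S : Finset ℤ) (h : ℝ) (hh : 0 < h) (d : ℕ) :
    ∀ (f : MvPolynomial (Fin 2) ℝ), f ≠ 0 → f.totalDegree ≤ d →
    ((Fintype.piFinset (fun _ : Fin 2 => S)).filter (fun c =>
      ∃ x ∈ closedBall (fun i => (c i : ℝ) * h) (3 * h), MvPolynomial.eval x f = 0)).card
      ≤ 32 * d * d * S.card := by
  induction d with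
  | zero =>
    intro f hf hd
    rw [Nat.le_zero, MvPolynomial.totalDegree_eq_zero_iff_eq_C] at hd
    have h0 : MvPolynomial.coeff 0 f ≠ 0 := by
      intro h0; rw [h0] at hd; exact hf (by simpa using hd)
    rw [hd]
    simp [h0]
  | succ d ih =>
    intro f hf hd
    by_cases hc : ∀ i, MvPolynomial.pderiv i f = 0
    · have hC := aux_pderiv_ne f hc
      have h0 : MvPolynomial.coeff 0 f ≠ 0 := by
        intro h0; rw [h0] at hC; exact hf (by simpa using hC)
      rw [hC]
      simp [h0]
    · push Not at hc
      obtain ⟨i₀, hi₀⟩ := hc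
      have hI := ih _ hi₀ (aux_pderiv_deg f d i₀ hd)
      have e1 := edge_count f hf _ hd 0 1 (by decide) S h (3 * h) hh
      have e2 := edge_count f hf _ hd 0 1 (by decide) S h (-(3 * h)) hh
      have e3 := edge_count f hf _ hd 1 0 (by decide) S h (3 * h) hh
      have e4 := edge_count f hf _ hd 1 0 (by decide) S h (-(3 * h)) hh
      set U := Fintype.piFinset (fun _ : Fin 2 => S)
      refine le_trans (Finset.card_le_card (t := ((((U.filter _) ∪ (U.filter _)) ∪ (U.filter _)) ∪
        (U.filter _)) ∪ (U.filter _)) ?_) (le_trans (Finset.card_union_le _ _)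
        (le_trans (add_le_add (le_trans (Finset.card_union_le _ _)
        (add_le_add (le_trans (Finset.card_union_le _ _)
        (add_le_add (le_trans (Finset.card_union_le _ _)
        (add_le_add e1 e2)) e3)) e4)) hI) ?_))
      · intro c hc
        obtain ⟨hcU, x, hx, hx0⟩ := Finset.mem_filter.1 hc
        simp only [Finset.mem_union, Finset.mem_filter, hcU, true_and]
        by_cases hs : ∀ x ∈ sphere (fun i => (c i : ℝ) * h) (3 * h), MvPolynomial.eval x f ≠ 0
        · right
          obtain ⟨y, hy, hy'⟩ := crit f _ _ x hx hx0 hs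
          exact ⟨y, hy, hy' i₀⟩
        · left
          push Not at hs
          obtain ⟨y, hy, hy0⟩ := hs
          have hle : ∀ i, |y i - c i * h| ≤ 3 * h := by
            intro i
            have := dist_le_pi_dist y (fun i => (c i : ℝ) * h) i
            rw [mem_sphere.1 hy, Real.dist_eq] at this
            exact this
          have hex : ∃ i, |y i - c i * h| = 3 * h := by
            by_contra hcon
            push Not at hcon
            have : dist y (fun i => (c i : ℝ) * h) < 3 * h := by
              rw [dist_pi_lt_iff (by positivity)]
              intro i
              rw [Real.dist_eq]
              exact lt_of_le_of_ne (hle i) (hcon i)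
            rw [mem_sphere.1 hy] at this
            exact lt_irrefl _ this
          have y01 : ∀ a, y 0 = a → (fun i : Fin 2 => if i = 0 then a else y 1) = y := by
            intro a ha; funext i; fin_cases i <;> simp [ha]
          have y10 : ∀ a, y 1 = a → (fun i : Fin 2 => if i = 1 then a else y 0) = y := by
            intro a ha; funext i; fin_cases i <;> simp [ha]
          obtain ⟨i, hi⟩ := hex
          rw [abs_eq (by positivity)] at hi
          fin_cases i
          · rcases hi with hi | hi
            · exact Or.inl (Or.inl (Or.inl ⟨y 1, by rw [y01 _ (by simp at hi; linarith)]; exact hy0, hle 1⟩))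
            · exact Or.inl (Or.inl (Or.inr ⟨y 1, by rw [y01 _ (by simp at hi; linarith)]; exact hy0, hle 1⟩))
          · rcases hi with hi | hi
            · exact Or.inl (Or.inr ⟨y 0, by rw [y10 _ (by simp at hi; linarith)]; exact hy0, hle 0⟩)
            · exact Or.inr ⟨y 0, by rw [y10 _ (by simp at hi; linarith)]; exact hy0, hle 0⟩
      · have : 32 * (d + 1) * (d + 1) * S.card = 32 * d * d * S.card + 64 * d * S.card + 32 * S.card := by ring
        rw [this]
        nlinarith [Nat.zero_le (d * S.card)]

open Classical in
theorem comb {α β ι : Type*} (P : Finset α) (Cv : Finset β) (R : α → β → Prop) (κ : α → ι)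
    (A M m : ℝ) (hA : 0 ≤ A)
    (hT : ((((P ×ˢ Cv).filter (fun e => R e.1 e.2)).image (fun e => (κ e.1, e.2))).card : ℝ) ≤ M)
    (hm : ∀ p ∈ P, ((P.filter (fun q => κ q = κ p)).card : ℝ) ≤ m)
    (hR : ∀ p ∈ P, ∀ q ∈ P, p ≠ q → ((Cv.filter (fun γ => R p γ ∧ R q γ)).card : ℝ) ≤ A) :
    (((P ×ˢ Cv).filter (fun e => R e.1 e.2)).card : ℝ) ^ 2 ≤
      M * (((P ×ˢ Cv).filter (fun e => R e.1 e.2)).card + A * (P.card * m)) := by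
  set E := (P ×ˢ Cv).filter (fun e => R e.1 e.2) with hE
  set k : α × β → ι × β := fun e => (κ e.1, e.2) with hk
  set T := E.image k with hTdef
  have h1 : (E.card : ℝ) = ∑ t ∈ T, ((E.filter (fun e => k e = t)).card : ℝ) := by
    exact_mod_cast Finset.card_eq_sum_card_fiberwise (fun e he => Finset.mem_image_of_mem k he)
  have h2 : (E.card : ℝ) ^ 2 ≤ T.card * ∑ t ∈ T, ((E.filter (fun e => k e = t)).card : ℝ) ^ 2 := by
    rw [h1]; exact sq_sum_le_card_mul_sum_sq
  -- pairs
  set W := (E ×ˢ E).filter (fun w => k w.1 = k w.2) with hW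
  have h3 : ∑ t ∈ T, ((E.filter (fun e => k e = t)).card : ℝ) ^ 2 = W.card := by
    have : W.card = ∑ t ∈ T, (W.filter (fun w => k w.1 = t)).card :=
      Finset.card_eq_sum_card_fiberwise (fun w hw => Finset.mem_image_of_mem k
        (Finset.mem_product.1 (Finset.mem_filter.1 hw).1).1)
    rw [this]
    push_cast
    apply Finset.sum_congr rfl
    intro t _
    have : W.filter (fun w => k w.1 = t) =
        (E.filter (fun e => k e = t)) ×ˢ (E.filter (fun e => k e = t)) := by
      ext w
      simp only [hW, Finset.mem_filter, Finset.mem_product]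
      constructor
      · rintro ⟨⟨⟨a, b⟩, c⟩, e⟩; exact ⟨⟨a, e⟩, b, c ▸ e⟩
      · rintro ⟨⟨a, e⟩, b, c⟩; exact ⟨⟨⟨a, b⟩, e.trans c.symm⟩, e⟩
    rw [this, Finset.card_product]; push_cast; ring
  set V := (P ×ˢ P).filter (fun v => κ v.2 = κ v.1) with hV
  have hVc : (V.card : ℝ) ≤ P.card * m := by
    have : V.card = ∑ p ∈ P, (V.filter (fun v => v.1 = p)).card :=
      Finset.card_eq_sum_card_fiberwise (fun w hw =>
        (Finset.mem_product.1 (Finset.mem_filter.1 hw).1).1)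
    rw [this]
    push_cast
    rw [← nsmul_eq_mul]
    apply Finset.sum_le_card_nsmul
    intro p hp
    refine le_trans ?_ (hm p hp)
    norm_cast
    apply Finset.card_le_card_of_injOn (fun v => v.2)
    · intro v hv
      simp only [hV, Finset.coe_filter, Finset.mem_filter, Finset.mem_product, Set.mem_ofPred_eq] at hv ⊢
      obtain ⟨⟨⟨_, a⟩, b⟩, c⟩ := hv
      exact ⟨a, c ▸ b⟩
    · intro v hv v' hv' hvv
      have a := (Finset.mem_filter.1 hv).2
      have b := (Finset.mem_filter.1 hv').2
      exact Prod.ext (a.trans b.symm) hvv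
  have h4 : (W.card : ℝ) ≤ E.card + A * (P.card * m) := by
    have hsplit : W.card = (W.filter (fun w => w.1.1 = w.2.1)).card +
        (W.filter (fun w => ¬ w.1.1 = w.2.1)).card :=
      (Finset.card_filter_add_card_filter_not _).symm
    have hd : (W.filter (fun w => w.1.1 = w.2.1)).card ≤ E.card := by
      apply Finset.card_le_card_of_injOn (fun w => w.1)
      · intro w hw
        exact (Finset.mem_product.1 (Finset.mem_filter.1 (Finset.mem_filter.1 hw).1).1).1
      · intro w hw w' hw' hww
        obtain ⟨a1, a2⟩ := Finset.mem_filter.1 hw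
        obtain ⟨b1, b2⟩ := Finset.mem_filter.1 hw'
        have a3 := (Prod.ext_iff.1 (Finset.mem_filter.1 a1).2).2
        have b3 := (Prod.ext_iff.1 (Finset.mem_filter.1 b1).2).2
        have hww' : w.1 = w'.1 := hww
        simp only [hk] at a3 b3
        refine Prod.ext hww' (Prod.ext ?_ ?_)
        · rw [← a2, ← b2, hww']
        · rw [← a3, ← b3, hww']
    set W' := W.filter (fun w => ¬ w.1.1 = w.2.1) with hW'
    have ho : (W'.card : ℝ) ≤ A * V.card := by
      have : W'.card = ∑ v ∈ V, (W'.filter (fun w => (w.1.1, w.2.1) = v)).card := by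
        apply Finset.card_eq_sum_card_fiberwise
        intro w hw
        simp only [hW', hW, hE, hV, hk, Finset.coe_filter, Finset.mem_filter, Finset.mem_product, Set.mem_ofPred_eq, Prod.mk.injEq] at hw ⊢
        tauto
      rw [this]
      push_cast
      rw [mul_comm, ← nsmul_eq_mul]
      apply Finset.sum_le_card_nsmul
      intro v hv
      obtain ⟨hv1, hv2⟩ := Finset.mem_filter.1 hv
      obtain ⟨hp, hq⟩ := Finset.mem_product.1 hv1
      by_cases hpq : v.1 = v.2
      · have : (W'.filter (fun w => (w.1.1, w.2.1) = v)) = ∅ := by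
          apply Finset.filter_eq_empty_iff.2
          intro w hw hwv
          apply (Finset.mem_filter.1 hw).2
          rw [← hwv] at hpq
          exact hpq
        rw [this]; simpa using hA
      · refine le_trans ?_ (hR _ hp _ hq hpq)
        norm_cast
        apply Finset.card_le_card_of_injOn (fun w => w.1.2)
        · intro w hw
          simp only [hW', hW, hE, hk, Finset.coe_filter, Finset.mem_filter, Finset.mem_product, Set.mem_ofPred_eq, Prod.mk.injEq] at hw ⊢
          obtain ⟨⟨⟨⟨⟨⟨a1, a2⟩, a3⟩, ⟨b1, b2⟩, b3⟩, c1, c2⟩, dd⟩, rfl⟩ := hw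
          exact ⟨a2, a3, c2 ▸ b3⟩
        · intro w hw w' hw' hww
          simp only [hW', hW, hE, hk, Finset.coe_filter, Finset.mem_filter, Finset.mem_product, Set.mem_ofPred_eq, Prod.mk.injEq] at hw hw'
          obtain ⟨⟨⟨_, c1, c2⟩, dd⟩, e⟩ := hw
          obtain ⟨⟨⟨_, c1', c2'⟩, dd'⟩, e'⟩ := hw'
          have e2 := Prod.ext_iff.1 (e.trans e'.symm)
          have hww' : w.1.2 = w'.1.2 := hww
          exact Prod.ext (Prod.ext e2.1 hww') (Prod.ext e2.2 (c2.symm.trans (hww'.trans c2')))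
    have hsplit' : (W.card : ℝ) = (W.filter (fun w => w.1.1 = w.2.1)).card + W'.card := by
      exact_mod_cast hsplit
    have hd' : ((W.filter (fun w => w.1.1 = w.2.1)).card : ℝ) ≤ E.card := by exact_mod_cast hd
    have := mul_le_mul_of_nonneg_left hVc hA
    linarith
  rw [h3] at h2
  calc (E.card : ℝ) ^ 2 ≤ T.card * W.card := h2
    _ ≤ M * (E.card + A * (P.card * m)) :=
      mul_le_mul hT h4 (by positivity) (le_trans (by positivity) hT)

/-- cell index -/
def cellIdx (h : ℝ) (p : R2) : Fin 2 → ℤ := fun i => ⌊p i / h⌋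

theorem cellIdx_near (h : ℝ) (hh : 0 < h) (p : R2) (i : Fin 2) :
    (cellIdx h p i : ℝ) * h ≤ p i ∧ p i < (cellIdx h p i : ℝ) * h + h := by
  have h1 : (⌊p i / h⌋ : ℝ) ≤ p i / h := Int.floor_le _
  have h2 : p i / h < ⌊p i / h⌋ + 1 := Int.lt_floor_add_one _
  rw [le_div_iff₀ hh] at h1
  rw [div_lt_iff₀ hh] at h2
  exact ⟨h1, by unfold cellIdx; linarith⟩

open Classical in
theorem packing (P : Finset R2) (h s : ℝ) (hs : 0 < s) (hsh : s ≤ h)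
    (hsep : ∀ p ∈ P, ∀ q ∈ P, p ≠ q → s ≤ dist p q) (p₀ : R2) :
    ((P.filter (fun q => cellIdx h q = cellIdx h p₀)).card : ℝ) ≤ (4 * h / s) ^ 2 := by
  have hh : 0 < h := hs.trans_le hsh
  set c := cellIdx h p₀ with hc
  set B : Finset (Fin 2 → ℤ) := Fintype.piFinset (fun i => Finset.Icc ⌊(c i * h) * 2 / s⌋ ⌊(c i * h + h) * 2 / s⌋)
  have h1 : (P.filter (fun q => cellIdx h q = c)).card ≤ B.card := by
    apply Finset.card_le_card_of_injOn (fun q i => ⌊q i * 2 / s⌋)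
    · intro q hq
      obtain ⟨_, hq2⟩ := Finset.mem_filter.1 hq
      rw [Finset.mem_coe, Fintype.mem_piFinset]
      intro i
      have := cellIdx_near h hh q i
      rw [hq2] at this
      rw [Finset.mem_Icc]
      constructor
      · apply Int.floor_le_floor
        have := this.1
        gcongr
      · apply Int.floor_le_floor
        have := this.2.le
        gcongr
    · intro q hq q' hq' hqq
      by_contra hne
      have hd := hsep q (Finset.mem_filter.1 hq).1 q' (Finset.mem_filter.1 hq').1 hne
      have hi : ∀ i, dist (q i) (q' i) ^ 2 < s ^ 2 / 2 := by
        intro i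
        have e : ⌊q i * 2 / s⌋ = ⌊q' i * 2 / s⌋ := congrFun hqq i
        have := Int.abs_sub_lt_one_of_floor_eq_floor e
        rw [← sub_div, abs_div, abs_of_pos hs, div_lt_one hs, ← sub_mul, abs_mul] at this
        rw [Real.dist_eq]
        norm_num at this
        nlinarith [abs_nonneg (q i - q' i)]
      have h2 : dist q q' ^ 2 < s ^ 2 := by
        rw [EuclideanSpace.dist_eq, Real.sq_sqrt (by positivity), Fin.sum_univ_two]
        linarith [hi 0, hi 1]
      have : s ^ 2 ≤ dist q q' ^ 2 := by gcongr
      linarith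
  have h2 : ∀ i, ((Finset.Icc ⌊(c i * h) * 2 / s⌋ ⌊(c i * h + h) * 2 / s⌋).card : ℝ) ≤ 4 * h / s := by
    intro i
    rw [Int.card_Icc]
    have e1 : (⌊(c i * h + h) * 2 / s⌋ : ℝ) ≤ (c i * h + h) * 2 / s := Int.floor_le _
    have e2 : (c i * h) * 2 / s < (⌊(c i * h) * 2 / s⌋ : ℝ) + 1 := Int.lt_floor_add_one _
    have e0 : ⌊(c i * h) * 2 / s⌋ ≤ ⌊(c i * h + h) * 2 / s⌋ := by
      apply Int.floor_le_floor
      gcongr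
      linarith
    have e3 : (((⌊(c i * h + h) * 2 / s⌋ + 1 - ⌊(c i * h) * 2 / s⌋).toNat : ℤ) : ℝ) =
        (⌊(c i * h + h) * 2 / s⌋ : ℝ) + 1 - ⌊(c i * h) * 2 / s⌋ := by
      rw [Int.toNat_of_nonneg (by omega)]; push_cast; ring
    rw [Int.cast_natCast] at e3
    rw [e3]
    have e4 : (c i * h + h) * 2 / s = (c i * h) * 2 / s + 2 * (h / s) := by ring
    have e5 : 1 ≤ h / s := by rwa [one_le_div hs]
    have e6 : 4 * h / s = 4 * (h / s) := by ring
    rw [e6]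
    linarith
  calc ((P.filter (fun q => cellIdx h q = c)).card : ℝ) ≤ B.card := by exact_mod_cast h1
    _ ≤ (4 * h / s) ^ 2 := by
      rw [Fintype.card_piFinset, Fin.prod_univ_two, sq]
      push_cast
      exact mul_le_mul (h2 0) (h2 1) (by positivity) (by positivity)

open Classical in
theorem core (C₀ : ℕ) (h s ρ a A : ℝ) (hh : 0 < h) (hh1 : h ≤ 1) (hs : 0 < s) (hsh : s ≤ h)
    (hs2 : s ^ 2 = h ^ 3) (hρ : ρ ≤ h) (ha : 1 ≤ a) (haA : a ^ 2 = A)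
    (P : Finset R2) (Cv : Finset (Set R2))
    (hball : (P : Set R2) ⊆ ball (0 : R2) 1)
    (hP : (P.card : ℝ) ≤ 1 / h ^ 3)
    (hsep : ∀ p ∈ P, ∀ q ∈ P, p ≠ q → s ≤ dist p q)
    (hCv : (Cv.card : ℝ) ≤ 1 / h ^ 3)
    (hcur : ∀ γ ∈ Cv, IsAlgCurve C₀ γ)
    (hR : ∀ p ∈ P, ∀ q ∈ P, p ≠ q →
      ((Cv.filter (fun γ => infDist p γ ≤ ρ ∧ infDist q γ ≤ ρ)).card : ℝ) ≤ A) :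
    (((P ×ˢ Cv).filter (fun e => infDist e.1 e.2 ≤ ρ)).card : ℝ) ≤
      (128 * C₀ * C₀ + 17) * (a * (1 / h ^ 4)) := by
  set S : Finset ℤ := Finset.Icc ⌊-1 / h⌋ ⌊1 / h⌋ with hS
  have hScard : (S.card : ℝ) ≤ 4 * (1 / h) := by
    rw [hS, Int.card_Icc]
    have e5 : 1 ≤ 1 / h := by rwa [one_le_div hh]
    have e1 : (⌊1 / h⌋ : ℝ) ≤ 1 / h := Int.floor_le _
    have e2 : -1 / h < (⌊-1 / h⌋ : ℝ) + 1 := Int.lt_floor_add_one _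
    have e4 : -1 / h = - (1 / h) := by ring
    have e0 : ⌊-1 / h⌋ ≤ ⌊1 / h⌋ := by
      apply Int.floor_le_floor
      linarith
    have e3 : (((⌊1 / h⌋ + 1 - ⌊-1 / h⌋).toNat : ℤ) : ℝ) = (⌊1 / h⌋ : ℝ) + 1 - ⌊-1 / h⌋ := by
      rw [Int.toNat_of_nonneg (by omega)]; push_cast; ring
    rw [Int.cast_natCast] at e3
    rw [e3]
    linarith
  have hidx : ∀ p ∈ P, ∀ i, cellIdx h p i ∈ S := by
    intro p hp i
    have h1 : ‖p‖ < 1 := by simpa using hball hp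
    have h2 := (EuclideanSpace.norm_eq p) ▸ h1
    have h3 : |p i| ≤ ‖p‖ := by
      have := PiLp.norm_apply_le p i
      simpa using this
    have h4 := abs_le.1 (h3.trans h1.le)
    rw [hS, Finset.mem_Icc]
    exact ⟨Int.floor_le_floor (by have := h4.1; gcongr), Int.floor_le_floor (by have := h4.2; gcongr)⟩
  have hT : ((((P ×ˢ Cv).filter (fun e => infDist e.1 e.2 ≤ ρ)).image
      (fun e => (cellIdx h e.1, e.2))).card : ℝ) ≤ (128 * C₀ * C₀ + 1) * (1 / h ^ 4) := by
    set T := ((P ×ˢ Cv).filter (fun e => infDist e.1 e.2 ≤ ρ)).image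
      (fun e => (cellIdx h e.1, e.2)) with hTdef
    have hmT : ∀ t ∈ T, ∃ p ∈ P, t.2 ∈ Cv ∧ infDist p t.2 ≤ ρ ∧ cellIdx h p = t.1 := by
      intro t ht
      obtain ⟨e, he, rfl⟩ := Finset.mem_image.1 ht
      obtain ⟨h1, h2⟩ := Finset.mem_filter.1 he
      obtain ⟨h3, h4⟩ := Finset.mem_product.1 h1
      exact ⟨e.1, h3, h4, h2, rfl⟩
    have h1 : T.card = ∑ γ ∈ Cv, (T.filter (fun t => t.2 = γ)).card := by
      apply Finset.card_eq_sum_card_fiberwise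
      intro t ht
      obtain ⟨p, _, h2, _⟩ := hmT t ht
      exact h2
    have h2 : ∀ γ ∈ Cv, (T.filter (fun t => t.2 = γ)).card ≤
        32 * C₀ * C₀ * S.card + (if γ = ∅ then P.card else 0) := by
      intro γ hγ
      have hinj : InjOn (fun t : (Fin 2 → ℤ) × Set R2 => t.1) (T.filter (fun t => t.2 = γ)) := by
        intro t ht t' ht' htt
        exact Prod.ext htt ((Finset.mem_filter.1 ht).2.trans (Finset.mem_filter.1 ht').2.symm)
      split_ifs with hemp
      · refine le_trans ?_ (Nat.le_add_left _ _)
        refine le_trans (Finset.card_le_card_of_injOn (t := P.image (cellIdx h)) _ ?_ hinj)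
          Finset.card_image_le
        intro t ht
        obtain ⟨p, hp, _, _, h4⟩ := hmT t (Finset.mem_filter.1 ht).1
        exact Finset.mem_image.2 ⟨p, hp, h4⟩
      · rw [add_zero]
        obtain ⟨f, hf, hd, hfγ⟩ := hcur γ hγ
        refine le_trans (Finset.card_le_card_of_injOn _ ?_ hinj) (cell_count S h hh C₀ f hf hd)
        intro t ht
        obtain ⟨ht1, ht2⟩ := Finset.mem_filter.1 ht
        obtain ⟨p, hp, _, h3, h4⟩ := hmT t ht1
        rw [ht2] at h3
        have h5 : infDist p γ < 2 * h := by linarith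
        obtain ⟨y, hy, hpy⟩ := (infDist_lt_iff (Set.nonempty_iff_ne_empty.2 hemp)).1 h5
        rw [Finset.mem_coe, Finset.mem_filter, Fintype.mem_piFinset]
        refine ⟨fun i => by have := hidx p hp i; rw [h4] at this; exact this, fun i => y i, ?_, ?_⟩
        · rw [mem_closedBall, dist_pi_le_iff (by positivity)]
          intro i
          have h6 := cellIdx_near h hh p i
          have h7 : |(p - y) i| ≤ ‖p - y‖ := by
            have := PiLp.norm_apply_le (p - y) i
            simpa using this
          rw [← dist_eq_norm] at h7
          have h8 := abs_le.1 (h7.trans hpy.le)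
          simp only [PiLp.sub_apply] at h8
          rw [h4] at h6
          rw [Real.dist_eq, abs_le]
          constructor <;> linarith [h6.1, h6.2, h8.1, h8.2]
        · rw [hfγ] at hy
          exact hy
    have h3 : (T.card : ℝ) ≤ Cv.card * (32 * C₀ * C₀ * S.card) + P.card := by
      have : T.card ≤ Cv.card * (32 * C₀ * C₀ * S.card) + P.card := by
        rw [h1]
        refine (Finset.sum_le_sum h2).trans ?_
        rw [Finset.sum_add_distrib, Finset.sum_const, smul_eq_mul, Finset.sum_ite_eq']
        gcongr
        split_ifs <;> simp
      exact_mod_cast this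
    have e1 : 1 / h ^ 3 ≤ 1 / h ^ 4 := by
      apply one_div_le_one_div_of_le (by positivity)
      exact pow_le_pow_of_le_one hh.le hh1 (by norm_num)
    calc (T.card : ℝ) ≤ Cv.card * (32 * C₀ * C₀ * S.card) + P.card := h3
      _ ≤ (1 / h ^ 3) * (32 * C₀ * C₀ * (4 * (1 / h))) + 1 / h ^ 4 := by
        have := hP.trans e1
        gcongr
      _ = (128 * C₀ * C₀ + 1) * (1 / h ^ 4) := by field_simp; ring
  have hm : ∀ p ∈ P, ((P.filter (fun q => cellIdx h q = cellIdx h p)).card : ℝ) ≤ 16 / h := by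
    intro p _
    refine (packing P h s hs hsh hsep p).trans (le_of_eq ?_)
    rw [div_pow, hs2]; field_simp; ring
  have hA : 0 ≤ A := haA ▸ sq_nonneg a
  have hmain := comb P Cv (fun p γ => infDist p γ ≤ ρ) (cellIdx h) A ((128 * C₀ * C₀ + 1) * (1 / h ^ 4)) (16 / h) hA
    (by convert hT) (by convert hm) (by convert hR)
  set x : ℝ := (((P ×ˢ Cv).filter (fun e => infDist e.1 e.2 ≤ ρ)).card : ℝ) with hx
  set D : ℝ := 1 / h ^ 4 with hD
  have hD0 : 0 < D := by positivity
  have hPm : (P.card : ℝ) * (16 / h) ≤ 16 * D := by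
    calc (P.card : ℝ) * (16 / h) ≤ (1 / h ^ 3) * (16 / h) := by gcongr
      _ = 16 * D := by rw [hD]; field_simp
  set B : ℝ := 128 * C₀ * C₀ + 1 with hB
  have hB1 : 1 ≤ B := by rw [hB]; have : (0:ℝ) ≤ 128 * C₀ * C₀ := by positivity
                         linarith
  have hx0 : 0 ≤ x := by positivity
  have h5 : x ^ 2 ≤ B * D * (x + A * (16 * D)) := hmain.trans (by gcongr)
  have hgoal : (128 * (C₀:ℝ) * C₀ + 17) = B + 16 := by rw [hB]; ring
  rw [hgoal]
  set y := a * D with hy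
  have hDy : D ≤ y := by rw [hy]; nlinarith
  have h6 : x ^ 2 ≤ B * y * x + 16 * B * y ^ 2 := by
    have e1 : B * D * (A * (16 * D)) = 16 * B * y ^ 2 := by rw [hy, ← haA]; ring
    have e2 : B * D * x ≤ B * y * x := by gcongr
    linarith
  by_contra hcon
  push Not at hcon
  have hy0 : 0 < y := hD0.trans_le hDy
  have hxB : B * y ≤ x := by nlinarith
  nlinarith [mul_pos hy0 hy0, mul_nonneg hy0.le (sub_nonneg.2 hxB), mul_pos (sub_pos.2 hcon) (hcon.trans' (by positivity : 0 < (B+16)*y))]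

/-- **Theorem (Lemma 6.26, a planar incidence bound).** Let `Pts ⊂ B(0,1) ⊂ ℝ²` be a set of
at most `δ⁻¹` points that are `δ^(1/2)`-separated, and let `Crvs` be a set of at most `δ⁻¹`
algebraic curves of degree at most `C₀`. If for any two distinct points of `Pts` there are at
most `A` curves of `Crvs` passing `δ^(1−Cε)`-close to both, then the number of pairs
`(p, γ)` with `dist(p, γ) ≤ δ^(1−Cε)` is at most `K δ^(−C'ε) A^(1/2) δ^(−4/3)`. -/
theorem planar_incidence_bound (C₀ : ℕ) (hC₀ : 1 ≤ C₀) (C : ℝ) (hC : 0 < C) :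
    ∃ K C' : ℝ, 0 < K ∧ 0 < C' ∧
      ∀ (δ ε A : ℝ), 0 < δ → δ < 1 → 0 < ε → 1 ≤ A →
      ∀ (Pts : Finset R2) (Crvs : Finset (Set R2)),
        (Pts : Set R2) ⊆ ball (0 : R2) 1 →
        ((Pts.card : ℝ) ≤ δ ^ (-(1:ℝ))) →
        (∀ p ∈ Pts, ∀ q ∈ Pts, p ≠ q → δ ^ ((1:ℝ)/2) ≤ dist p q) →
        ((Crvs.card : ℝ) ≤ δ ^ (-(1:ℝ))) →
        (∀ γ ∈ Crvs, IsAlgCurve C₀ γ) →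
        (∀ p ∈ Pts, ∀ q ∈ Pts, p ≠ q →
          ({γ : Set R2 | γ ∈ Crvs ∧ infDist p γ ≤ δ ^ (1 - C * ε) ∧
              infDist q γ ≤ δ ^ (1 - C * ε)}.ncard : ℝ) ≤ A) →
        ({pg : R2 × Set R2 | pg.1 ∈ Pts ∧ pg.2 ∈ Crvs ∧
            infDist pg.1 pg.2 ≤ δ ^ (1 - C * ε)}.ncard : ℝ) ≤
          K * δ ^ (-(C' * ε)) * A ^ ((1:ℝ)/2) * δ ^ (-(4:ℝ)/3) := by
  classical
  refine ⟨128 * C₀ * C₀ + 17, C, by positivity, hC, ?_⟩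
  intro δ ε A hδ hδ1 hε hA Pts Crvs hball hP hsep hCv hcur hR
  set ρ := δ ^ (1 - C * ε) with hρ
  have hset : {pg : R2 × Set R2 | pg.1 ∈ Pts ∧ pg.2 ∈ Crvs ∧ infDist pg.1 pg.2 ≤ ρ} =
      ((Pts ×ˢ Crvs).filter (fun e => infDist e.1 e.2 ≤ ρ) : Finset (R2 × Set R2)) := by
    ext e
    simp [and_assoc]
  rw [hset, Set.ncard_coe_finset]
  have ha1 : 1 ≤ A ^ ((1:ℝ)/2) := Real.one_le_rpow hA (by norm_num)
  have hK1 : (1:ℝ) ≤ 128 * C₀ * C₀ + 17 := by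
    have : (0:ℝ) ≤ 128 * C₀ * C₀ := by positivity
    linarith
  by_cases hbig : 2 / 3 ≤ C * ε
  · have h1 : (((Pts ×ˢ Crvs).filter (fun e => infDist e.1 e.2 ≤ ρ)).card : ℝ) ≤
        Pts.card * Crvs.card := by
      have := (Finset.card_filter_le (Pts ×ˢ Crvs) (fun e => infDist e.1 e.2 ≤ ρ))
      rw [Finset.card_product] at this
      exact_mod_cast this
    have h2 : (Pts.card : ℝ) * Crvs.card ≤ δ ^ (-(C * ε)) * δ ^ (-(4:ℝ)/3) := by
      calc (Pts.card : ℝ) * Crvs.card ≤ δ ^ (-(1:ℝ)) * δ ^ (-(1:ℝ)) := by gcongr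
        _ = δ ^ (-(2:ℝ)) := by rw [← Real.rpow_add hδ]; norm_num
        _ ≤ δ ^ (-(C * ε) + -(4:ℝ)/3) :=
          Real.rpow_le_rpow_of_exponent_ge hδ hδ1.le (by linarith)
        _ = _ := Real.rpow_add hδ _ _
    have h3 : (1:ℝ) ≤ (128 * C₀ * C₀ + 17) * A ^ ((1:ℝ)/2) := by nlinarith
    have h4 : 0 < δ ^ (-(C * ε)) * δ ^ (-(4:ℝ)/3) := by positivity
    calc _ ≤ _ := h1.trans h2
      _ = 1 * (δ ^ (-(C * ε)) * δ ^ (-(4:ℝ)/3)) := (one_mul _).symm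
      _ ≤ ((128 * C₀ * C₀ + 17) * A ^ ((1:ℝ)/2)) * (δ ^ (-(C * ε)) * δ ^ (-(4:ℝ)/3)) := by gcongr
      _ = _ := by ring
  · push Not at hbig
    set h := δ ^ ((1:ℝ)/3) with hh
    have hhpos : 0 < h := by positivity
    have h3 : δ ^ (-(1:ℝ)) = 1 / h ^ 3 := by
      rw [hh, ← Real.rpow_natCast, ← Real.rpow_mul hδ.le, one_div, ← Real.rpow_neg hδ.le]
      norm_num
    have h4 : δ ^ (-(4:ℝ)/3) = 1 / h ^ 4 := by
      rw [hh, ← Real.rpow_natCast, ← Real.rpow_mul hδ.le, one_div, ← Real.rpow_neg hδ.le]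
      norm_num
    have hs2 : (δ ^ ((1:ℝ)/2)) ^ 2 = h ^ 3 := by
      rw [hh, ← Real.rpow_natCast, ← Real.rpow_mul hδ.le, ← Real.rpow_natCast,
        ← Real.rpow_mul hδ.le]
      norm_num
    have haA : (A ^ ((1:ℝ)/2)) ^ 2 = A := by
      rw [← Real.rpow_natCast, ← Real.rpow_mul (by linarith)]
      norm_num
    rw [h3] at hP hCv
    have hmain := core C₀ h (δ ^ ((1:ℝ)/2)) ρ (A ^ ((1:ℝ)/2)) A hhpos
      (Real.rpow_le_one hδ.le hδ1.le (by norm_num)) (by positivity)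
      (Real.rpow_le_rpow_of_exponent_ge hδ hδ1.le (by norm_num)) hs2
      (Real.rpow_le_rpow_of_exponent_ge hδ hδ1.le (by linarith)) ha1 haA Pts Crvs hball hP hsep
      hCv hcur (by
        intro p hp q hq hpq
        have := hR p hp q hq hpq
        have he : {γ : Set R2 | γ ∈ Crvs ∧ infDist p γ ≤ ρ ∧ infDist q γ ≤ ρ} =
          (Crvs.filter (fun γ => infDist p γ ≤ ρ ∧ infDist q γ ≤ ρ) : Finset (Set R2)) := by
          ext e; simp
        rw [he, Set.ncard_coe_finset] at this
        convert this)
    have h5 : 1 ≤ δ ^ (-(C * ε)) :=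
      Real.one_le_rpow_of_pos_of_le_one_of_nonpos hδ hδ1.le (by have := mul_pos hC hε; linarith)
    rw [h4]
    calc _ ≤ (128 * (C₀:ℝ) * C₀ + 17) * (A ^ ((1:ℝ)/2) * (1 / h ^ 4)) := by convert hmain
      _ = 1 * ((128 * (C₀:ℝ) * C₀ + 17) * (A ^ ((1:ℝ)/2) * (1 / h ^ 4))) := (one_mul _).symm
      _ ≤ δ ^ (-(C * ε)) * ((128 * (C₀:ℝ) * C₀ + 17) * (A ^ ((1:ℝ)/2) * (1 / h ^ 4))) := by gcongr
      _ = _ := by ring
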